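/- Let $\Omega$ be a compact metrizable space with an action of the group $G = \mathrm{Sym}_0(\mathbb{N})$ by homeomorphisms, and let $\mu$ be a $G$-invariant ergodic Borel probability measure. Then the map $\phi : C(\Omega) \to \mathbb{R}$ sending $f$ to the $\mu$-almost-sure constant value of the limit of ergodic averages of $f$ under $G$ (equivalently, $\phi(f) = \int f\, d\mu$) is a positive linear functional of norm $1$ satisfying $\phi(f) \phi(h) = \lim_{m} \phi(f \cdot (h \circ g_m))$ whenever $(g_m) \subseteq G$ is a sequence of permutations such that for every finite $A \subseteq \mathbb{N}$, eventually $g_m$ maps a set of coordinates on which $h$ is approximately supported disjointly from $A$. -/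

import Mathlib

open MeasureTheory Filter

open scoped RealInnerProductSpace

section Hilbert

variable {G H : Type*} [Group G] [NormedAddCommGroup H] [InnerProductSpace ℝ H]
  [DistribMulAction G H] [SMulCommClass G ℝ H] [IsIsometricSMul G H]

/-- The closed convex hull of an orbit of an isometric linear action on a Hilbert space contains
a fixed vector. -/
theorem exists_fixed_mem_closure_convexHull_orbit [CompleteSpace H] (v : H) :
    ∃ u ∈ closure (convexHull ℝ (MulAction.orbit G v)), ∀ g : G, g • u = u := by
  set C := closure (convexHull ℝ (MulAction.orbit G v)) with hC
  have hconv : Convex ℝ C := (convex_convexHull ℝ _).closure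
  have hne : C.Nonempty :=
    ⟨v, subset_closure (subset_convexHull ℝ _ (MulAction.mem_orbit_self v))⟩
  have hsmul : ∀ g : G, ∀ w ∈ C, g • w ∈ C := by
    intro g
    have hpre : convexHull ℝ (MulAction.orbit G v) ⊆
        (fun w : H => g • w) ⁻¹' convexHull ℝ (MulAction.orbit G v) := by
      refine convexHull_min (fun w hw => ?_) ?_
      · obtain ⟨k, rfl⟩ := hw
        exact subset_convexHull ℝ _ ⟨g * k, mul_smul g k v⟩
      · intro x hx y hy a b ha hb hab
        simp only [Set.mem_preimage, smul_add, smul_comm g] at hx hy ⊢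
        exact convex_convexHull ℝ _ hx hy ha hb hab
    intro w hw
    exact map_mem_closure (isometry_smul H g).continuous hw hpre
  obtain ⟨u, huC, hu⟩ :=
    exists_norm_eq_iInf_of_complete_convex hne isClosed_closure.isComplete hconv (0 : H)
  refine ⟨u, huC, fun g => ?_⟩
  have hle := (norm_eq_iInf_iff_real_inner_le_zero hconv huC).1 hu _ (hsmul g u huC)
  have hnorm : ‖g • u‖ = ‖u‖ := by
    simpa using (isometry_smul H g).dist_eq u 0
  rw [zero_sub, inner_neg_left, inner_sub_right, real_inner_self_eq_norm_sq] at hle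
  have hsq : ‖g • u - u‖ ^ 2 ≤ 0 := by
    rw [norm_sub_sq_real, hnorm, real_inner_comm]
    linarith
  exact sub_eq_zero.1 (norm_eq_zero.1 (pow_eq_zero_iff two_ne_zero |>.1
    (le_antisymm hsq (sq_nonneg _))))

/-- If, for every finite set `F` of group elements, some translate of `F` pairs `f` with the
translates of `v` to the constant value `c`, then `f` pairs with every fixed vector in the closed
convex hull of the orbit of `v` to `c` as well. -/
theorem inner_eq_of_fixed_mem_closure_convexHull_orbit {v u f : H} {c : ℝ}
    (hu : u ∈ closure (convexHull ℝ (MulAction.orbit G v))) (hfix : ∀ g : G, g • u = u)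
    (hc : ∀ F : Finset G, ∃ s : G, ∀ p ∈ F, ⟪f, s • p • v⟫ = c) : ⟪f, u⟫ = c := by
  classical
  have hclose : ∀ ε > 0, |⟪f, u⟫ - c| ≤ ‖f‖ * ε := by
    intro ε hε
    obtain ⟨w, hw, huw⟩ := Metric.mem_closure_iff.1 hu ε hε
    rw [convexHull_eq_union_convexHull_finite_subsets] at hw
    simp only [Set.mem_iUnion] at hw
    obtain ⟨t, ht, hwt⟩ := hw
    obtain ⟨F, rfl⟩ : ∃ F : Finset G, t = F.image (· • v) := by
      obtain ⟨F, -, hF⟩ := Finset.subset_set_image_iff.1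
        (show (t : Set H) ⊆ (· • v) '' (Set.univ : Set G) by rwa [Set.image_univ])
      exact ⟨F, hF.symm⟩
    obtain ⟨s, hs⟩ := hc F
    have hsw : ⟪f, s • w⟫ = c := by
      suffices hsub : convexHull ℝ ((F.image (· • v) : Finset H) : Set H) ⊆
          {w | ⟪f, s • w⟫ = c} from hsub hwt
      refine convexHull_min (fun w hw => ?_) ?_
      · simp only [Finset.coe_image, Set.mem_image, Finset.mem_coe] at hw
        obtain ⟨p, hp, rfl⟩ := hw
        exact hs p hp
      · intro x hx y hy a b _ _ hab
        simp only [Set.mem_ofPred_eq] at hx hy ⊢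
        rw [smul_add, smul_comm s, smul_comm s, inner_add_right, inner_smul_right,
          inner_smul_right, hx, hy, ← add_mul, hab, one_mul]
    calc |⟪f, u⟫ - c| = |⟪f, s • u - s • w⟫| := by rw [inner_sub_right, hsw, hfix]
      _ ≤ ‖f‖ * ‖s • u - s • w‖ := abs_real_inner_le_norm _ _
      _ ≤ ‖f‖ * ε := by
        rw [← dist_eq_norm, (isometry_smul H s).dist_eq]
        gcongr
  have hlim : Tendsto (fun ε : ℝ => ‖f‖ * ε) (nhdsWithin 0 (Set.Ioi 0)) (nhds 0) := by
    have hcont : Continuous fun ε : ℝ => ‖f‖ * ε := by fun_prop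
    simpa using (hcont.tendsto 0).mono_left nhdsWithin_le_nhds
  have h0 := ge_of_tendsto hlim (eventually_nhdsWithin_of_forall fun ε hε => hclose ε hε)
  exact sub_eq_zero.1 (abs_nonpos_iff.1 h0)

end Hilbert

section Ergodic

variable {G α : Type*} [Group G] [MulAction G α] [MeasurableSpace α] {μ : Measure α}

/-- For a countable group, ergodicity may be tested on strictly invariant sets. -/
theorem ergodicSMul_of_forall_preimage_smul_eq [Countable G] [MeasurableConstSMul G α]
    [IsProbabilityMeasure μ] [SMulInvariantMeasure G α μ]
    (h : ∀ s, MeasurableSet s → (∀ g : G, (g • ·) ⁻¹' s = s) → μ s = 0 ∨ μ s = 1) :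
    ErgodicSMul G α μ where
  aeconst_of_forall_preimage_smul_ae_eq {s} hs hinv := by
    set t := ⋂ g : G, (g • ·) ⁻¹' s with ht
    have hts : t =ᵐ[μ] s := by
      have hae : ∀ᵐ x ∂μ, ∀ g : G, (g • x ∈ s ↔ x ∈ s) :=
        ae_all_iff.2 fun g => (hinv g).mem_iff
      refine eventuallyEq_set.2 (hae.mono fun x hx => ?_)
      simp [ht, hx]
    have htm : MeasurableSet t :=
      MeasurableSet.iInter fun g => measurable_const_smul g hs
    have htinv : ∀ g : G, (g • ·) ⁻¹' t = t := by
      intro g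
      ext x
      simp only [ht, Set.mem_preimage, Set.mem_iInter, smul_smul]
      exact ⟨fun hx k => by simpa using hx (k * g⁻¹), fun hx k => hx _⟩
    refine EventuallyConst.congr ?_ hts
    rw [eventuallyConst_set']
    rcases h t htm htinv with h0 | h1
    · exact Or.inl (ae_eq_empty.2 h0)
    · right
      rw [ae_eq_univ, prob_compl_eq_zero_iff htm]
      exact h1

/-- Almost everywhere invariant functions of an ergodic action are almost everywhere constant. -/
theorem ae_eq_const_of_ergodicSMul [ErgodicSMul G α μ] {u : α → ℝ} (hu : AEMeasurable u μ)
    (hinv : ∀ g : G, (fun x => u (g • x)) =ᵐ[μ] u) : ∃ a, u =ᵐ[μ] fun _ => a := by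
  refine exists_eventuallyEq_const_of_forall_separating MeasurableSet fun U hU => ?_
  refine eventuallyConst_set.1 (aeconst_of_forall_preimage_smul_ae_eq G (s := u ⁻¹' U)
    (hu.nullMeasurable hU) fun g => ?_)
  exact ((hinv g).mono fun x hx => by simp only [Set.mem_preimage, hx]).set_eq

/-- If correlations between `f` and finitely many translates of `h` can be made simultaneously
equal to `c` by a further translation, then `c` is the product of the integrals. -/
theorem eq_integral_mul_integral_of_ergodicSMul [MeasurableConstSMul G α] [IsProbabilityMeasure μ]
    [ErgodicSMul G α μ] {f h : α → ℝ} (hf : MemLp f 2 μ) (hh : MemLp h 2 μ) {c : ℝ}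
    (hc : ∀ F : Finset G, ∃ s : G, ∀ p ∈ F, ∫ x, f x * h (p • s • x) ∂μ = c) :
    c = (∫ x, f x ∂μ) * ∫ x, h x ∂μ := by
  classical
  obtain ⟨u, hu, hfix⟩ :=
    exists_fixed_mem_closure_convexHull_orbit (G := Gᵈᵐᵃ) (hh.toLp h)
  have hinner : ∀ {e : α → ℝ} (he : MemLp e 2 μ) (s p : G),
      ⟪he.toLp e, DomMulAct.mk s • DomMulAct.mk p • hh.toLp h⟫ =
        ∫ x, e x * h (p • s • x) ∂μ := by
    intro e he s p
    rw [DomMulAct.mk_smul_toLp, DomMulAct.mk_smul_toLp, L2.inner_def]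
    refine integral_congr_ae ?_
    filter_upwards [he.coeFn_toLp, (((hh.comp_measurePreserving
      (measurePreserving_smul p μ)).comp_measurePreserving
      (measurePreserving_smul s μ))).coeFn_toLp] with x hx hy
    rw [hx]
    exact (congrArg (⟪e x, ·⟫) hy).trans (by simp [mul_comm])
  have hval : ∀ {e : α → ℝ} (he : MemLp e 2 μ) {d : ℝ},
      (∀ F : Finset G, ∃ s : G, ∀ p ∈ F, ∫ x, e x * h (p • s • x) ∂μ = d) →
      ∫ x, e x * u x ∂μ = d := by
    intro e he d hd
    rw [← inner_eq_of_fixed_mem_closure_convexHull_orbit (f := he.toLp e) (c := d) hu hfix ?_,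
      L2.inner_def]
    · refine integral_congr_ae ?_
      filter_upwards [he.coeFn_toLp] with x hx
      rw [hx]
      simp [mul_comm]
    · intro F
      obtain ⟨s, hs⟩ := hd (F.image DomMulAct.mk.symm)
      refine ⟨DomMulAct.mk s, fun p hp => ?_⟩
      rw [← hs _ (Finset.mem_image_of_mem _ hp), ← hinner he]
      simp
  obtain ⟨a, ha⟩ : ∃ a, u =ᵐ[μ] fun _ => a := by
    refine ae_eq_const_of_ergodicSMul (G := G) (Lp.aestronglyMeasurable u).aemeasurable fun g => ?_
    have hsm := DomMulAct.smul_Lp_ae_eq (DomMulAct.mk g) u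
    rw [hfix] at hsm
    exact hsm.symm
  have hmul : ∀ e : α → ℝ, ∫ x, e x * u x ∂μ = (∫ x, e x ∂μ) * a := by
    intro e
    rw [← integral_mul_const]
    exact integral_congr_ae (ha.mono fun x hx => by simp only [hx])
  have hone : a = ∫ x, h x ∂μ := by
    have h1 := hval (e := fun _ => 1) (memLp_const 1) (d := ∫ x, h x ∂μ) fun F =>
      ⟨1, fun p _ => by
        simpa using! integral_smul_eq_self (μ := μ) h (g := p)⟩
    rw [hmul] at h1
    simpa using h1
  rw [← hval hf hc, hmul, hone]

end Ergodic

section ContinuousMap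

variable {X : Type*} [TopologicalSpace X] [CompactSpace X] [MeasurableSpace X] {μ : Measure X}

theorem memLp_continuousMap [BorelSpace X] [IsFiniteMeasure μ] (f : C(X, ℝ)) (p : ENNReal) :
    MemLp f p μ :=
  MemLp.of_bound f.continuous.measurable.aestronglyMeasurable ‖f‖
    (Eventually.of_forall f.norm_coe_le_norm)

theorem abs_integral_continuousMap_le [IsProbabilityMeasure μ] (f : C(X, ℝ)) :
    |∫ x, f x ∂μ| ≤ ‖f‖ := by
  simpa using norm_integral_le_of_norm_le_const (μ := μ) (Eventually.of_forall f.norm_coe_le_norm)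

end ContinuousMap

section FinitaryPerm

/-- The group of finitely supported permutations. -/
def finitaryPerm (α : Type*) : Subgroup (Equiv.Perm α) where
  carrier := {g | {n | g n ≠ n}.Finite}
  one_mem' := by simp
  mul_mem' {g h} hg hh := by
    refine (Set.Finite.union hg hh).subset fun n hn => ?_
    by_contra hcon
    simp only [Set.mem_union, Set.mem_ofPred_eq, not_or, not_not] at hcon hn
    exact hn (by rw [Equiv.Perm.mul_apply, hcon.2, hcon.1])
  inv_mem' {g} hg := by
    refine Set.Finite.subset hg fun n hn => ?_
    simp only [Set.mem_ofPred_eq] at hn ⊢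
    exact fun h => hn (Equiv.Perm.inv_eq_iff_eq.2 h.symm)

theorem mem_finitaryPerm {α : Type*} {g : Equiv.Perm α} :
    g ∈ finitaryPerm α ↔ {n | g n ≠ n}.Finite :=
  Iff.rfl

instance {α : Type*} [Countable α] : Countable (finitaryPerm α) := by
  classical
  let graph : finitaryPerm α → Finset (α × α) := fun g =>
    (mem_finitaryPerm.1 g.2).toFinset.image fun n => (n, g.1 n)
  have hgraph : ∀ g n m, (n, m) ∈ graph g ↔ g.1 n ≠ n ∧ g.1 n = m := by
    intro g n m
    simp only [graph, Finset.mem_image, Set.Finite.mem_toFinset, Set.mem_ofPred_eq,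
      Prod.mk.injEq]
    exact ⟨by rintro ⟨_, h, rfl, rfl⟩; exact ⟨h, rfl⟩, fun h => ⟨n, h.1, rfl, h.2⟩⟩
  refine Function.Injective.countable (f := graph) fun g h hgh => ?_
  refine Subtype.ext (Equiv.ext fun n => ?_)
  have key := fun m => (hgraph g n m).symm.trans ((by rw [hgh]) : _ ↔ (n, m) ∈ graph h) |>.trans
    (hgraph h n m)
  by_cases hg : g.1 n = n
  · by_cases hh : h.1 n = n
    · rw [hg, hh]
    · exact ((key (h.1 n)).2 ⟨hh, rfl⟩).2
  · exact (((key (g.1 n)).1 ⟨hg, rfl⟩).2).symm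

/-- Every injection of a finite set extends to a finitely supported permutation. -/
theorem exists_finitaryPerm_eqOn {α : Type*} [DecidableEq α] (S : Finset α) (e : α → α)
    (he : Set.InjOn e S) : ∃ p : finitaryPerm α, ∀ n ∈ S, p.1 n = e n := by
  induction S using Finset.induction_on with
  | empty => exact ⟨1, by simp⟩
  | insert a S ha ih =>
    obtain ⟨p, hp⟩ := ih (he.mono (by simp))
    have hswap : Equiv.swap (p.1 a) (e a) ∈ finitaryPerm α := by
      refine mem_finitaryPerm.2 (Set.Finite.subset (Set.toFinite {p.1 a, e a}) fun n hn => ?_)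
      by_contra hcon
      simp only [Set.mem_insert_iff, Set.mem_singleton_iff, not_or] at hcon
      exact hn (Equiv.swap_apply_of_ne_of_ne hcon.1 hcon.2)
    refine ⟨⟨_, hswap⟩ * p, fun n hn => ?_⟩
    simp only [Subgroup.coe_mul, Equiv.Perm.mul_apply]
    rcases Finset.mem_insert.1 hn with rfl | hnS
    · exact Equiv.swap_apply_left _ _
    · have hna : n ≠ a := fun h => ha (h ▸ hnS)
      rw [Equiv.swap_apply_of_ne_of_ne (fun h => hna (p.1.injective h)), hp n hnS]
      rw [hp n hnS]
      exact fun h => hna (he (by simp [hnS]) (by simp) h)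

end FinitaryPerm

section Arrays

variable {k : ℕ} {K : Fin k → Type*}

instance : MulAction (finitaryPerm ℕ) ((i : Fin k) → (Fin (i : ℕ) → ℕ) → K i) where
  smul g ω i a := ω i fun j => g.1.symm (a j)
  one_smul _ := rfl
  mul_smul _ _ _ := rfl

theorem finitaryPerm_smul_apply (g : finitaryPerm ℕ)
    (ω : (i : Fin k) → (Fin (i : ℕ) → ℕ) → K i) (i : Fin k) (a : Fin (i : ℕ) → ℕ) :
    (g • ω) i a = ω i fun j => g.1.symm (a j) :=
  rfl

/-- `f` depends only on the entries of an array whose indices all lie in `A`. -/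
def SupportedOn {β : Type*} (A : Finset ℕ)
    (f : ((i : Fin k) → (Fin (i : ℕ) → ℕ) → K i) → β) : Prop :=
  ∀ x y, (∀ i a, (∀ j, a j ∈ A) → x i a = y i a) → f x = f y

/-- For an exchangeable measure, the correlation of `f` with a translate of `h` that is moved off
the support of `f` does not depend on the translate. -/
theorem integral_mul_smul_eq_of_disjoint [MeasurableSpace ((i : Fin k) → (Fin (i : ℕ) → ℕ) → K i)]
    [MeasurableConstSMul (finitaryPerm ℕ) ((i : Fin k) → (Fin (i : ℕ) → ℕ) → K i)]
    {μ : Measure ((i : Fin k) → (Fin (i : ℕ) → ℕ) → K i)}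
    [SMulInvariantMeasure (finitaryPerm ℕ) ((i : Fin k) → (Fin (i : ℕ) → ℕ) → K i) μ]
    {f h : ((i : Fin k) → (Fin (i : ℕ) → ℕ) → K i) → ℝ} {A B : Finset ℕ}
    (hf : SupportedOn A f) (hh : SupportedOn B h) {s t : finitaryPerm ℕ}
    (hs : ∀ b ∈ B, s.1.symm b ∉ A) (ht : ∀ b ∈ B, t.1.symm b ∉ A) :
    ∫ x, f x * h (s • x) ∂μ = ∫ x, f x * h (t • x) ∂μ := by
  obtain ⟨p, hp⟩ := exists_finitaryPerm_eqOn (A ∪ B.image t.1.symm)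
    (fun n => if n ∈ A then n else s.1.symm (t.1 n)) (by
      intro m hm n hn hmn
      simp only [Finset.coe_union, Finset.coe_image, Set.mem_union, Finset.mem_coe,
        Set.mem_image] at hm hn
      by_cases hmA : m ∈ A <;> by_cases hnA : n ∈ A <;>
        simp only [hmA, hnA, if_true, if_false] at hmn
      · exact hmn
      · obtain ⟨b, hb, rfl⟩ := hn.resolve_left hnA
        rw [Equiv.apply_symm_apply] at hmn
        exact absurd (hmn ▸ hmA) (hs b hb)
      · obtain ⟨b, hb, rfl⟩ := hm.resolve_left hmA
        rw [Equiv.apply_symm_apply] at hmn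
        exact absurd (hmn ▸ hnA) (hs b hb)
      · exact t.1.injective (s.1.symm.injective hmn))
  have hpA : ∀ n ∈ A, p.1.symm n = n := by
    intro n hn
    rw [Equiv.symm_apply_eq, hp n (Finset.mem_union_left _ hn), if_pos hn]
  have hpB : ∀ b ∈ B, p.1.symm (s.1.symm b) = t.1.symm b := by
    intro b hb
    rw [Equiv.symm_apply_eq, hp _ (Finset.mem_union_right _ (Finset.mem_image_of_mem _ hb)),
      if_neg (ht b hb), Equiv.apply_symm_apply]
  rw [← integral_smul_eq_self (μ := μ) (fun x => f x * h (s • x)) (g := p)]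
  refine integral_congr_ae (Eventually.of_forall fun x => ?_)
  have hfx : f (p • x) = f x := hf _ _ fun i a ha => by
    rw [finitaryPerm_smul_apply]
    exact congrArg (x i) (funext fun j => hpA _ (ha j))
  have hhx : h (s • p • x) = h (t • x) := hh _ _ fun i a ha => by
    simp only [finitaryPerm_smul_apply]
    exact congrArg (x i) (funext fun j => hpB _ (ha j))
  simp only [hfx, hhx]

/-- Some finitely supported permutation moves a finite set off another one. -/
theorem exists_finitaryPerm_symm_notMem (A B : Finset ℕ) :
    ∃ s : finitaryPerm ℕ, ∀ b ∈ B, s.1.symm b ∉ A := by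
  obtain ⟨p, hp⟩ := exists_finitaryPerm_eqOn B (fun n => n + (A.sup id + 1))
    (add_left_injective _).injOn
  refine ⟨p⁻¹, fun b hb hA => ?_⟩
  have hle : b + (A.sup id + 1) ≤ A.sup id := by
    rw [← hp b hb]
    exact Finset.le_sup (f := id) hA
  omega

/-- For an ergodic exchangeable measure, finitely supported functions become uncorrelated as soon
as the translate of the second is moved off the support of the first. -/
theorem integral_mul_smul_eq_mul_integral
    [MeasurableSpace ((i : Fin k) → (Fin (i : ℕ) → ℕ) → K i)]
    [MeasurableConstSMul (finitaryPerm ℕ) ((i : Fin k) → (Fin (i : ℕ) → ℕ) → K i)]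
    {μ : Measure ((i : Fin k) → (Fin (i : ℕ) → ℕ) → K i)} [IsProbabilityMeasure μ]
    [ErgodicSMul (finitaryPerm ℕ) ((i : Fin k) → (Fin (i : ℕ) → ℕ) → K i) μ]
    {f h : ((i : Fin k) → (Fin (i : ℕ) → ℕ) → K i) → ℝ} {A B : Finset ℕ}
    (hfL : MemLp f 2 μ) (hhL : MemLp h 2 μ)
    (hf : SupportedOn A f) (hh : SupportedOn B h) {s : finitaryPerm ℕ}
    (hs : ∀ b ∈ B, s.1.symm b ∉ A) :
    ∫ x, f x * h (s • x) ∂μ = (∫ x, f x ∂μ) * ∫ x, h x ∂μ := by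
  refine eq_integral_mul_integral_of_ergodicSMul (G := finitaryPerm ℕ) hfL hhL fun F => ?_
  obtain ⟨t, ht⟩ := exists_finitaryPerm_symm_notMem A
    (F.biUnion fun p => B.image p.1.symm)
  refine ⟨t, fun p hp => ?_⟩
  simp only [smul_smul]
  refine integral_mul_smul_eq_of_disjoint hf hh (fun b hb => ?_) hs
  exact ht _ (Finset.mem_biUnion.2 ⟨p, hp, Finset.mem_image_of_mem _ hb⟩)

/-- Replace the entries of `x` having an index at least `n` by those of `x₀`. -/
def truncateArray (x₀ : (i : Fin k) → (Fin (i : ℕ) → ℕ) → K i) (n : ℕ)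
    (x : (i : Fin k) → (Fin (i : ℕ) → ℕ) → K i) : (i : Fin k) → (Fin (i : ℕ) → ℕ) → K i :=
  fun i a => if ∀ j, a j ∈ Finset.range n then x i a else x₀ i a

theorem supportedOn_comp_truncateArray {β : Type*} (x₀ : (i : Fin k) → (Fin (i : ℕ) → ℕ) → K i)
    (n : ℕ) (f : ((i : Fin k) → (Fin (i : ℕ) → ℕ) → K i) → β) :
    SupportedOn (Finset.range n) fun x => f (truncateArray x₀ n x) := by
  refine fun x y hxy => congrArg f (funext fun i => funext fun a => ?_)
  unfold truncateArray
  split_ifs with ha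
  exacts [hxy i a ha, rfl]

variable [∀ i, TopologicalSpace (K i)]

theorem continuous_truncateArray (x₀ : (i : Fin k) → (Fin (i : ℕ) → ℕ) → K i) (n : ℕ) :
    Continuous (truncateArray x₀ n) := by
  refine continuous_pi fun i => continuous_pi fun a => ?_
  unfold truncateArray
  split_ifs <;> fun_prop

theorem tendsto_truncateArray (x₀ x : (i : Fin k) → (Fin (i : ℕ) → ℕ) → K i) :
    Tendsto (fun n => truncateArray x₀ n x) atTop (nhds x) := by
  refine tendsto_pi_nhds.2 fun i => tendsto_pi_nhds.2 fun a => ?_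
  refine tendsto_const_nhds.congr' ?_
  filter_upwards [eventually_gt_atTop (Finset.univ.sup a)] with n hn
  unfold truncateArray
  rw [if_pos fun j => Finset.mem_range.2 ((Finset.le_sup (Finset.mem_univ j)).trans_lt hn)]

theorem continuous_finitaryPerm_smul (g : finitaryPerm ℕ) :
    Continuous fun x : (i : Fin k) → (Fin (i : ℕ) → ℕ) → K i => g • x := by
  refine continuous_pi fun i => continuous_pi fun a => ?_
  simp only [finitaryPerm_smul_apply]
  fun_prop

variable [∀ i, CompactSpace (K i)] [MeasurableSpace ((i : Fin k) → (Fin (i : ℕ) → ℕ) → K i)]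
  [BorelSpace ((i : Fin k) → (Fin (i : ℕ) → ℕ) → K i)]
  {μ : Measure ((i : Fin k) → (Fin (i : ℕ) → ℕ) → K i)} [IsProbabilityMeasure μ]

/-- A continuous function on arrays is an `L¹` limit of its truncations. -/
theorem exists_supportedOn_integral_abs_sub_lt
    (f : C(((i : Fin k) → (Fin (i : ℕ) → ℕ) → K i), ℝ)) {ε : ℝ} (hε : 0 < ε) :
    ∃ (A : Finset ℕ) (f' : C(((i : Fin k) → (Fin (i : ℕ) → ℕ) → K i), ℝ)),
      SupportedOn A f' ∧ ‖f'‖ ≤ ‖f‖ ∧ ∫ x, |f x - f' x| ∂μ < ε := by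
  obtain ⟨x₀⟩ : Nonempty ((i : Fin k) → (Fin (i : ℕ) → ℕ) → K i) := μ.nonempty_of_neZero
  let f' : ℕ → C(((i : Fin k) → (Fin (i : ℕ) → ℕ) → K i), ℝ) := fun n =>
    f.comp ⟨_, continuous_truncateArray x₀ n⟩
  have hnorm : ∀ n, ‖f' n‖ ≤ ‖f‖ := fun n =>
    (ContinuousMap.norm_le _ (norm_nonneg _)).2 fun x => f.norm_coe_le_norm _
  have hlim : Tendsto (fun n => ∫ x, |f x - f' n x| ∂μ) atTop
      (nhds (∫ _x : (i : Fin k) → (Fin (i : ℕ) → ℕ) → K i, (0 : ℝ) ∂μ)) := by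
    refine tendsto_integral_of_dominated_convergence (fun _ => ‖f‖ + ‖f‖) (fun n => ?_)
      (integrable_const _) (fun n => Eventually.of_forall fun x => ?_)
      (Eventually.of_forall fun x => ?_)
    · exact (f - f' n).continuous.abs.measurable.aestronglyMeasurable
    · rw [Real.norm_eq_abs, abs_abs]
      exact (abs_sub _ _).trans (add_le_add (f.norm_coe_le_norm x)
        (((f' n).norm_coe_le_norm x).trans (hnorm n)))
    · have hx : Tendsto (fun n => f' n x) atTop (nhds (f x)) :=
        (f.continuous.tendsto x).comp (tendsto_truncateArray x₀ x)
      simpa using (hx.const_sub (f x)).abs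
  rw [integral_zero] at hlim
  obtain ⟨n, hn⟩ := (hlim.eventually (gt_mem_nhds hε)).exists
  exact ⟨Finset.range n, f' n, supportedOn_comp_truncateArray x₀ n f, hnorm n, hn⟩

/-- Changing `f` and `h` slightly in `L¹` changes their correlations slightly, uniformly over
all translates. -/
theorem abs_integral_mul_smul_sub_le
    [MeasurableConstSMul (finitaryPerm ℕ) ((i : Fin k) → (Fin (i : ℕ) → ℕ) → K i)]
    [SMulInvariantMeasure (finitaryPerm ℕ) ((i : Fin k) → (Fin (i : ℕ) → ℕ) → K i) μ]
    (f f' h h' : C(((i : Fin k) → (Fin (i : ℕ) → ℕ) → K i), ℝ)) (s : finitaryPerm ℕ) :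
    |(∫ x, f x * h (s • x) ∂μ) - ∫ x, f' x * h' (s • x) ∂μ| ≤
      ‖h‖ * (∫ x, |f x - f' x| ∂μ) + ‖f'‖ * ∫ x, |h x - h' x| ∂μ := by
  let S : C((i : Fin k) → (Fin (i : ℕ) → ℕ) → K i, (i : Fin k) → (Fin (i : ℕ) → ℕ) → K i) :=
    ⟨_, continuous_finitaryPerm_smul s⟩
  have hint : ∀ e : C(((i : Fin k) → (Fin (i : ℕ) → ℕ) → K i), ℝ), Integrable e μ := fun e =>
    memLp_one_iff_integrable.1 (memLp_continuousMap e 1)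
  have hh : ∫ x, |h x - h' x| ∂μ = ∫ x, |h (s • x) - h' (s • x)| ∂μ :=
    (integral_smul_eq_self (μ := μ) (fun x => |h x - h' x|) (g := s)).symm
  have h₁ : Integrable (fun x => f x * h (s • x)) μ := hint (f * h.comp S)
  have h₂ : Integrable (fun x => f' x * h' (s • x)) μ := hint (f' * h'.comp S)
  have h₃ : Integrable (fun x => |f x - f' x|) μ := (hint (f - f')).abs
  have h₄ : Integrable (fun x => |h (s • x) - h' (s • x)|) μ := (hint ((h - h').comp S)).abs
  rw [hh, ← integral_const_mul, ← integral_const_mul, ← integral_sub h₁ h₂,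
    ← integral_add (h₃.const_mul _) (h₄.const_mul _)]
  refine (abs_integral_le_integral_abs).trans (integral_mono (h₁.sub h₂).abs
    ((h₃.const_mul _).add (h₄.const_mul _)) fun x => ?_)
  calc |f x * h (s • x) - f' x * h' (s • x)|
      = |h (s • x) * (f x - f' x) + f' x * (h (s • x) - h' (s • x))| := by ring_nf
    _ ≤ |h (s • x)| * |f x - f' x| + |f' x| * |h (s • x) - h' (s • x)| := by
      rw [← abs_mul, ← abs_mul]
      exact abs_add_le _ _
    _ ≤ ‖h‖ * |f x - f' x| + ‖f'‖ * |h (s • x) - h' (s • x)| := by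
      gcongr
      exacts [h.norm_coe_le_norm _, f'.norm_coe_le_norm _]

/-- Mixing of ergodic exchangeable measures along permutations moving every finite set off every
other one. -/
theorem tendsto_integral_mul_smul
    [MeasurableConstSMul (finitaryPerm ℕ) ((i : Fin k) → (Fin (i : ℕ) → ℕ) → K i)]
    [ErgodicSMul (finitaryPerm ℕ) ((i : Fin k) → (Fin (i : ℕ) → ℕ) → K i) μ]
    (f h : C(((i : Fin k) → (Fin (i : ℕ) → ℕ) → K i), ℝ)) (g : ℕ → finitaryPerm ℕ)
    (hg : ∀ A B : Finset ℕ, ∀ᶠ m in atTop, ∀ b ∈ B, (g m).1 b ∉ A) :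
    Tendsto (fun m => ∫ x, f x * h (g m • x) ∂μ) atTop
      (nhds ((∫ x, f x ∂μ) * ∫ x, h x ∂μ)) := by
  refine Metric.tendsto_atTop.2 fun ε hε => eventually_atTop.1 ?_
  obtain ⟨δ, hδ, hδε⟩ : ∃ δ > 0, 2 * (‖h‖ * δ + ‖f‖ * δ) < ε := by
    refine ⟨ε / (2 * (‖h‖ + ‖f‖ + 1)), by positivity, ?_⟩
    have hpos : 0 < ‖h‖ + ‖f‖ + 1 := by positivity
    rw [← add_mul, ← mul_assoc, ← mul_div_assoc, div_lt_iff₀ (by positivity)]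
    nlinarith
  obtain ⟨A, f', hf'A, hf'f, hf'⟩ := exists_supportedOn_integral_abs_sub_lt (μ := μ) f hδ
  obtain ⟨B, h', hh'B, hh'h, hh'⟩ := exists_supportedOn_integral_abs_sub_lt (μ := μ) h hδ
  have hbound : ‖h‖ * (∫ x, |f x - f' x| ∂μ) + ‖f'‖ * ∫ x, |h x - h' x| ∂μ ≤
      ‖h‖ * δ + ‖f‖ * δ := by
    gcongr
  have hprod : |(∫ x, f x ∂μ) * (∫ x, h x ∂μ) - (∫ x, f' x ∂μ) * ∫ x, h' x ∂μ| ≤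
      ‖h‖ * δ + ‖f‖ * δ := by
    have hnorm : ∀ e : C(((i : Fin k) → (Fin (i : ℕ) → ℕ) → K i), ℝ), |∫ x, e x ∂μ| ≤ ‖e‖ :=
      abs_integral_continuousMap_le
    have hsub : ∀ e e' : C(((i : Fin k) → (Fin (i : ℕ) → ℕ) → K i), ℝ),
        |(∫ x, e x ∂μ) - ∫ x, e' x ∂μ| ≤ ∫ x, |e x - e' x| ∂μ := fun e e' => by
      rw [← integral_sub (memLp_one_iff_integrable.1 (memLp_continuousMap e 1))
        (memLp_one_iff_integrable.1 (memLp_continuousMap e' 1))]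
      exact abs_integral_le_integral_abs
    calc |(∫ x, f x ∂μ) * (∫ x, h x ∂μ) - (∫ x, f' x ∂μ) * ∫ x, h' x ∂μ|
        = |(∫ x, h x ∂μ) * ((∫ x, f x ∂μ) - ∫ x, f' x ∂μ) +
            (∫ x, f' x ∂μ) * ((∫ x, h x ∂μ) - ∫ x, h' x ∂μ)| := by ring_nf
      _ ≤ |∫ x, h x ∂μ| * |(∫ x, f x ∂μ) - ∫ x, f' x ∂μ| +
            |∫ x, f' x ∂μ| * |(∫ x, h x ∂μ) - ∫ x, h' x ∂μ| := by
        rw [← abs_mul, ← abs_mul]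
        exact abs_add_le _ _
      _ ≤ ‖h‖ * δ + ‖f‖ * δ := by
        gcongr
        exacts [hnorm h, (hsub f f').trans hf'.le, (hnorm f').trans hf'f,
          (hsub h h').trans hh'.le]
  filter_upwards [hg B A] with m hm
  have hdisj : ∀ b ∈ B, (g m).1.symm b ∉ A := fun b hb hA =>
    hm _ hA (by rwa [Equiv.apply_symm_apply])
  have hcorr := abs_integral_mul_smul_sub_le (μ := μ) f f' h h' (g m)
  rw [integral_mul_smul_eq_mul_integral (memLp_continuousMap f' 2) (memLp_continuousMap h' 2)
    hf'A hh'B hdisj] at hcorr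
  rw [Real.dist_eq]
  rw [abs_sub_comm] at hprod
  exact (abs_sub_le _ _ _).trans_lt (by linarith)

end Arrays

/-- For an ergodic exchangeable measure on a closed `Sym₀`-invariant subset
`Ω` of `∏ i ≤ k, K i ^ (ℕ^i)`, the functional `φ(f) = ∫ f dμ` is a positive linear
functional of norm 1, and `φ(f)·φ(h) = lim_m φ(f · (h ∘ g_m))` whenever the finitely
supported permutations `g_m` eventually move any finite coordinate set off any finite set. -/
theorem stmt5 {k : ℕ} (K : Fin k → Type*) [∀ i, MetricSpace (K i)]
    [∀ i, CompactSpace (K i)]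
    [MeasurableSpace ((i : Fin k) → (Fin (i : ℕ) → ℕ) → K i)]
    [BorelSpace ((i : Fin k) → (Fin (i : ℕ) → ℕ) → K i)]
    (T : Equiv.Perm ℕ → ((i : Fin k) → (Fin (i : ℕ) → ℕ) → K i) →
      ((i : Fin k) → (Fin (i : ℕ) → ℕ) → K i))
    (hT : ∀ g ω i a, T g ω i a = ω i fun j => g.symm (a j))
    (Ω : Set ((i : Fin k) → (Fin (i : ℕ) → ℕ) → K i)) (hΩc : IsClosed Ω)
    (hΩinv : ∀ g : Equiv.Perm ℕ, {n | g n ≠ n}.Finite → T g '' Ω = Ω)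
    (μ : Measure ((i : Fin k) → (Fin (i : ℕ) → ℕ) → K i))
    [IsProbabilityMeasure μ] (hμΩ : μ Ω = 1)
    (hinv : ∀ g : Equiv.Perm ℕ, {n | g n ≠ n}.Finite → Measure.map (T g) μ = μ)
    (herg : ∀ s, MeasurableSet s →
      (∀ g : Equiv.Perm ℕ, {n | g n ≠ n}.Finite → T g ⁻¹' s = s) →
      μ s = 0 ∨ μ s = 1) :
    (∀ f : C(((i : Fin k) → (Fin (i : ℕ) → ℕ) → K i), ℝ), 0 ≤ f → 0 ≤ ∫ x, f x ∂μ) ∧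
    (∫ _x, (1 : ℝ) ∂μ = 1) ∧
    (∀ f : C(((i : Fin k) → (Fin (i : ℕ) → ℕ) → K i), ℝ), |∫ x, f x ∂μ| ≤ ‖f‖) ∧
    (∀ (f h : C(((i : Fin k) → (Fin (i : ℕ) → ℕ) → K i), ℝ)) (g : ℕ → Equiv.Perm ℕ),
      (∀ m, {n | (g m) n ≠ n}.Finite) →
      (∀ A B : Finset ℕ, ∀ᶠ m in atTop, ∀ b ∈ B, (g m) b ∉ A) →
      Tendsto (fun m => ∫ x, f x * h (T (g m) x) ∂μ) atTop
        (nhds ((∫ x, f x ∂μ) * (∫ x, h x ∂μ)))) := by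
  have hTsmul : ∀ g : finitaryPerm ℕ, T g.1 = (g • ·) := fun g =>
    funext fun ω => funext fun i => funext fun a => hT g.1 ω i a
  have hmeas : MeasurableConstSMul (finitaryPerm ℕ) ((i : Fin k) → (Fin (i : ℕ) → ℕ) → K i) :=
    ⟨fun g => (continuous_finitaryPerm_smul g).measurable⟩
  have hsmul : SMulInvariantMeasure (finitaryPerm ℕ)
      ((i : Fin k) → (Fin (i : ℕ) → ℕ) → K i) μ :=
    ⟨fun g s hs => by
      rw [← Measure.map_apply (measurable_const_smul g) hs, ← hTsmul, hinv g.1 g.2]⟩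
  have hergodic : ErgodicSMul (finitaryPerm ℕ) ((i : Fin k) → (Fin (i : ℕ) → ℕ) → K i) μ :=
    ergodicSMul_of_forall_preimage_smul_eq fun s hs hsinv =>
      herg s hs fun g hg => by rw [hTsmul ⟨g, hg⟩, hsinv]
  refine ⟨fun f hf => integral_nonneg hf, by simp, abs_integral_continuousMap_le,
    fun f h g hg hsep => ?_⟩
  have hlim := tendsto_integral_mul_smul (μ := μ) f h (fun m => ⟨g m, hg m⟩) hsep
  refine hlim.congr fun m => ?_
  rw [hTsmul ⟨g m, hg m⟩]
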